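/- Fix N ≥ 1 and a diagonal matrix D = diag(d_1,…,d_N) such that d_i − d_j is a positive integer whenever i < j. Let β be a strictly upper triangular complex N×N matrix and let v be holomorphic near 0 ∈ ℂ with v(0) = 1. Then the positive Birkhoff factor γ_v^+(z) = Te^{−(1/z)∫_1^{v(z)} u^Y(β) du/u} (time-ordered exponential along the straight path from 1 to v(z) of the 1-form −(1/z)·Σ_{n≥1} u^{n−1} β_n du) extends holomorphically to z = 0 with value lim_{z→0} γ_v^+(z) = e^{−sβ}, where s = v'(0). (This is the matrix form of the statement that under a change of local section σ_2 = α·σ_1 the regular values are related by γ_reg(y_0)_2 = e^{−sβ}·γ_reg(y_0)_1 with s = (dα/dz)(0).) -/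

import Mathlib

open MeasureTheory Filter Topology
noncomputable section
attribute [local instance] Matrix.normedAddCommGroup Matrix.normedSpace

/-- The graded component `x_n` of a matrix `x`, supported on the positions
`(i,j)` with `d i − d j = n`, for `D = diag d`. -/
def gpart {N : ℕ} (d : Fin N → ℂ) (n : ℕ) (x : Matrix (Fin N) (Fin N) ℂ) :
    Matrix (Fin N) (Fin N) ℂ :=
  Matrix.of fun i j => if d i - d j = (n : ℂ) then x i j else 0

/-- `u^Y(x)/u = Σ_{n≥1} u^{n−1} x_n`, which is entire in `u`. -/
def uYdiv {N : ℕ} (d : Fin N → ℂ) (u : ℂ) (x : Matrix (Fin N) (Fin N) ℂ) :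
    Matrix (Fin N) (Fin N) ℂ :=
  ∑' n : ℕ, u ^ n • gpart d (n + 1) x

/-- A strictly upper triangular matrix. -/
def SUT {N : ℕ} (x : Matrix (Fin N) (Fin N) ℂ) : Prop :=
  ∀ i j : Fin N, ¬ i < j → x i j = 0

/-- The ordered simplex `{a ≤ s 0 ≤ s 1 ≤ ⋯ ≤ s (n-1) ≤ b}`. -/
def orderedSimplex (n : ℕ) (a b : ℝ) : Set (Fin n → ℝ) :=
  {s | (∀ i, s i ∈ Set.Icc a b) ∧ Monotone s}

/-- A germ belonging to the subring `O ⊂ K` of germs holomorphic at `0`. -/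
def MemO (f : ℂ → ℂ) : Prop :=
  ∃ g : ℂ → ℂ, AnalyticAt ℂ g 0 ∧ f =ᶠ[𝓝[≠] (0 : ℂ)] g

/-- A germ belonging to `Q = z⁻¹ ℂ[z⁻¹]`: polynomials in `z⁻¹` without
constant term. -/
def MemQ (f : ℂ → ℂ) : Prop :=
  ∃ p : Polynomial ℂ, p.coeff 0 = 0 ∧
    ∀ᶠ z in 𝓝[≠] (0 : ℂ), f z = Polynomial.eval z⁻¹ p

/-- `Te^{−(1/z)∫_{c₀}^{c₁} u^Y(β) du/u}`: the time-ordered exponential of the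
1-form `−(1/z)·Σ_{n≥1} u^{n−1} β_n du` along the straight path from `c₀` to
`c₁` (pullback `t ↦ −(1/z)(c₁−c₀)·Σ_{n≥1} (c₀+t(c₁−c₀))^{n−1} β_n`). -/
def TexpPath {N : ℕ} (d : Fin N → ℂ) (β : Matrix (Fin N) (Fin N) ℂ)
    (z c₀ c₁ : ℂ) : Matrix (Fin N) (Fin N) ℂ :=
  ∑' n : ℕ, ∫ s in orderedSimplex n 0 1,
    (List.ofFn fun i : Fin n =>
      (-z⁻¹ * (c₁ - c₀)) • uYdiv d (c₀ + (s i : ℂ) * (c₁ - c₀)) β).prod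

/-- The matrix exponential `e^{x}` (a finite sum when `x` is nilpotent). -/
def matExp {N : ℕ} (x : Matrix (Fin N) (Fin N) ℂ) : Matrix (Fin N) (Fin N) ℂ :=
  ∑' n : ℕ, ((n.factorial : ℂ)⁻¹) • x ^ n

theorem uYdiv_eq_sum {N : ℕ} (d : Fin N → ℂ)
    (hd : ∀ i j : Fin N, i < j → ∃ n : ℕ, 0 < n ∧ d i - d j = (n : ℂ))
    (β : Matrix (Fin N) (Fin N) ℂ) (hβ : SUT β) :
    ∃ K : ℕ, (∀ u, uYdiv d u β = ∑ n ∈ Finset.range K, u ^ n • gpart d (n + 1) β) ∧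
      uYdiv d 1 β = β := by
  have hm : ∀ i j : Fin N, ∃ n : ℕ, i < j → 0 < n ∧ d i - d j = (n : ℂ) := by
    intro i j
    by_cases h : i < j
    · obtain ⟨n, hn⟩ := hd i j h
      exact ⟨n, fun _ => hn⟩
    · exact ⟨0, fun h' => absurd h' h⟩
  choose m hm using hm
  have hmK : ∀ i j, m i j ≤ ∑ i, ∑ j, m i j := fun i j =>
    (Finset.single_le_sum (f := fun j => m i j) (fun _ _ => Nat.zero_le _)
      (Finset.mem_univ j)).trans
    (Finset.single_le_sum (f := fun i => ∑ j, m i j) (fun _ _ => Nat.zero_le _)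
      (Finset.mem_univ i))
  have key : ∀ u, uYdiv d u β =
      ∑ n ∈ Finset.range (∑ i, ∑ j, m i j), u ^ n • gpart d (n + 1) β := by
    intro u
    refine tsum_eq_sum fun n hn => ?_
    rw [Finset.mem_range, not_lt] at hn
    have : gpart d (n + 1) β = 0 := by
      ext i j
      simp only [gpart, Matrix.of_apply, Matrix.zero_apply, ite_eq_right_iff]
      intro h
      by_cases hij : i < j
      · have h1 := (hm i j hij).2
        rw [h] at h1
        have h2 : n + 1 = m i j := by exact_mod_cast h1
        have h3 := hmK i j
        omega
      · exact hβ i j hij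
    rw [this, smul_zero]
  refine ⟨_, key, ?_⟩
  rw [key]
  ext i j
  simp only [one_pow, one_smul, Matrix.sum_apply, gpart, Matrix.of_apply]
  by_cases hij : i < j
  · obtain ⟨hpos, heq⟩ := hm i j hij
    rw [Finset.sum_eq_single (m i j - 1)]
    · rw [if_pos]
      rw [heq, Nat.sub_add_cancel hpos]
    · intro b _ hb
      rw [if_neg]
      rw [heq]
      intro h
      have : m i j = b + 1 := by exact_mod_cast h
      omega
    · intro h
      rw [Finset.mem_range] at h
      have := hmK i j
      omega
  · rw [hβ i j hij]
    simp

theorem SUT.smul {N : ℕ} {x : Matrix (Fin N) (Fin N) ℂ} (hx : SUT x) (c : ℂ) : SUT (c • x) :=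
  fun i j h => by simp [hx i j h]

theorem SUT.uYdiv {N : ℕ} {d : Fin N → ℂ} {β : Matrix (Fin N) (Fin N) ℂ}
    (hd : ∀ i j : Fin N, i < j → ∃ n : ℕ, 0 < n ∧ d i - d j = (n : ℂ))
    (hβ : SUT β) (u : ℂ) : SUT (uYdiv d u β) := by
  obtain ⟨K, hK, -⟩ := uYdiv_eq_sum d hd β hβ
  intro i j h
  rw [hK, Matrix.sum_apply]
  refine Finset.sum_eq_zero fun n _ => ?_
  simp [gpart, hβ i j h]

theorem SUT.list_prod_apply_eq_zero {N : ℕ} (l : List (Matrix (Fin N) (Fin N) ℂ))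
    (hl : ∀ x ∈ l, SUT x) (i j : Fin N) (h : (j : ℕ) < i + l.length) : l.prod i j = 0 := by
  induction l generalizing i with
  | nil =>
    rw [List.prod_nil, Matrix.one_apply_ne]
    rintro rfl
    simp at h
  | cons x l ih =>
    rw [List.prod_cons, Matrix.mul_apply]
    refine Finset.sum_eq_zero fun k _ => ?_
    by_cases hik : i < k
    · rw [ih (fun y hy => hl y (List.mem_cons_of_mem _ hy)), mul_zero]
      rw [List.length_cons] at h
      have : (i : ℕ) < k := hik
      omega
    · rw [hl x List.mem_cons_self i k hik, zero_mul]

theorem SUT.list_prod_eq_zero {N : ℕ} (l : List (Matrix (Fin N) (Fin N) ℂ))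
    (hl : ∀ x ∈ l, SUT x) (h : N ≤ l.length) : l.prod = 0 := by
  ext i j
  exact SUT.list_prod_apply_eq_zero l hl i j (by have := j.isLt; omega)

theorem SUT.pow_eq_zero {N n : ℕ} {x : Matrix (Fin N) (Fin N) ℂ} (hx : SUT x) (h : N ≤ n) :
    x ^ n = 0 := by
  rw [← List.prod_replicate]
  refine SUT.list_prod_eq_zero _ (fun y hy => ?_) (by simpa using h)
  rw [List.eq_of_mem_replicate hy]
  exact hx

theorem isCompact_orderedSimplex (n : ℕ) (a b : ℝ) : IsCompact (orderedSimplex n a b) := by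
  have : orderedSimplex n a b = (Set.univ.pi fun _ => Set.Icc a b) ∩
      ⋂ (i : Fin n) (j : Fin n) (_ : i ≤ j), {s | s i ≤ s j} := by
    ext s
    simp only [orderedSimplex, Set.mem_ofPred_eq, Set.mem_inter_iff, Set.mem_univ_pi, Set.mem_iInter]
    rfl
  rw [this]
  refine (isCompact_univ_pi fun _ => isCompact_Icc).inter_right ?_
  exact isClosed_iInter fun i => isClosed_iInter fun j => isClosed_iInter fun _ =>
    isClosed_le (continuous_apply i) (continuous_apply j)

theorem cons_mem_orderedSimplex_iff (n : ℕ) (a b t : ℝ) (s : Fin n → ℝ) :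
    (Fin.cons t s : Fin (n + 1) → ℝ) ∈ orderedSimplex (n + 1) a b ↔
      t ∈ Set.Icc a b ∧ s ∈ orderedSimplex n t b := by
  simp only [orderedSimplex, Set.mem_ofPred_eq, Fin.forall_fin_succ, Fin.cons_zero, Fin.cons_succ,
    Set.mem_Icc]
  constructor
  · rintro ⟨⟨ht, hs⟩, hmono⟩
    refine ⟨ht, fun i => ⟨?_, (hs i).2⟩, fun i j hij => ?_⟩
    · simpa using hmono (Fin.zero_le i.succ)
    · simpa using hmono (Fin.succ_le_succ_iff.2 hij)
  · rintro ⟨ht, hs, hmono⟩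
    refine ⟨⟨ht, fun i => ⟨ht.1.trans (hs i).1, (hs i).2⟩⟩, fun i j => ?_⟩
    refine Fin.cases ?_ (fun i => ?_) i <;> refine Fin.cases ?_ (fun j => ?_) j
    · simp
    · intro _
      simpa using (hs j).1
    · intro h
      simp at h
    · intro h
      simpa using hmono (Fin.succ_le_succ_iff.1 h)

theorem volume_orderedSimplex (n : ℕ) (a b : ℝ) (hab : a ≤ b) :
    volume (orderedSimplex n a b) = ENNReal.ofReal ((b - a) ^ n / n.factorial) := by
  induction n generalizing a with
  | zero =>
    have : orderedSimplex 0 a b = Set.univ := by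
      ext s
      simp [orderedSimplex, Subsingleton.monotone]
    rw [this]
    simp [volume_pi]
  | succ n ih =>
    have hmp := (volume_preserving_piFinSuccAbove (fun _ : Fin (n + 1) => ℝ) 0).symm
    have hmeas := (isCompact_orderedSimplex (n + 1) a b).measurableSet
    rw [← hmp.measure_preimage hmeas.nullMeasurableSet, Measure.volume_eq_prod,
      Measure.prod_apply (hmp.measurable hmeas)]
    have hslice : ∀ t : ℝ, volume (Prod.mk t ⁻¹'
        ((MeasurableEquiv.piFinSuccAbove (fun _ : Fin (n + 1) => ℝ) 0).symm ⁻¹'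
          orderedSimplex (n + 1) a b)) =
        (Set.Icc a b).indicator
          (fun t => ENNReal.ofReal ((b - t) ^ n / n.factorial)) t := by
      intro t
      have hpre : Prod.mk t ⁻¹'
          ((MeasurableEquiv.piFinSuccAbove (fun _ : Fin (n + 1) => ℝ) 0).symm ⁻¹'
            orderedSimplex (n + 1) a b) = {s | t ∈ Set.Icc a b ∧ s ∈ orderedSimplex n t b} := by
        ext s
        rw [Set.mem_ofPred_eq, ← cons_mem_orderedSimplex_iff]
        simp [MeasurableEquiv.piFinSuccAbove, Fin.insertNthEquiv]
      rw [hpre]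
      by_cases ht : t ∈ Set.Icc a b
      · rw [Set.indicator_of_mem ht, ← ih t ht.2]
        simp [ht.1, ht.2]
      · rw [Set.indicator_of_notMem ht]
        simp only [ht, false_and, Set.ofPred_false, measure_empty]
    simp_rw [hslice]
    rw [lintegral_indicator measurableSet_Icc, ← ofReal_integral_eq_lintegral_ofReal]
    · rw [integral_Icc_eq_integral_Ioc, ← intervalIntegral.integral_of_le hab,
        intervalIntegral.integral_div,
        intervalIntegral.integral_comp_sub_left (fun x => x ^ n) b, integral_pow]
      congr 1
      rw [Nat.factorial_succ]
      push_cast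
      simp only [sub_self, ne_eq, Nat.add_eq_zero_iff, one_ne_zero, and_false, not_false_eq_true,
        zero_pow, sub_zero]
      rw [div_div]
    · exact (Continuous.continuousOn (by fun_prop)).integrableOn_Icc
    · refine (ae_restrict_iff' measurableSet_Icc).2 (Eventually.of_forall fun t ht => ?_)
      have : 0 ≤ b - t := sub_nonneg.2 ht.2
      positivity

theorem exists_sum_pow_smul_expansion {N : ℕ} (A : ℕ → Matrix (Fin N) (Fin N) ℂ) (K : ℕ)
    {α : Type*} [TopologicalSpace α] (f : α → ℝ) (hf : Continuous f) :
    ∃ (ι : Type) (_ : Fintype ι) (e : ι → ℕ) (C : ι → α → Matrix (Fin N) (Fin N) ℂ),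
      (∀ k, Continuous (C k)) ∧ ∀ (x : α) (c : ℂ),
        ∑ k ∈ Finset.range K, (1 + (f x : ℂ) * c) ^ k • A k = ∑ k, c ^ e k • C k x := by
  refine ⟨Σ k : Fin K, Fin ((k : ℕ) + 1), inferInstance, fun p => p.2,
    fun p x => ((f x : ℂ) ^ (p.2 : ℕ) * ((p.1 : ℕ).choose p.2 : ℂ)) • A p.1,
    fun p => by fun_prop, fun x c => ?_⟩
  rw [Fintype.sum_sigma, Finset.sum_range]
  refine Finset.sum_congr rfl fun k _ => ?_
  rw [add_comm, add_pow, Finset.sum_range, Finset.sum_smul]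
  refine Finset.sum_congr rfl fun j _ => ?_
  rw [smul_smul]
  congr 1
  ring

theorem exists_list_prod_expansion {N : ℕ} (A : ℕ → Matrix (Fin N) (Fin N) ℂ) (K n : ℕ)
    {α : Type*} [TopologicalSpace α] (f : Fin n → α → ℝ) (hf : ∀ i, Continuous (f i)) :
    ∃ (ι : Type) (_ : Fintype ι) (e : ι → ℕ) (C : ι → α → Matrix (Fin N) (Fin N) ℂ),
      (∀ k, Continuous (C k)) ∧ ∀ (x : α) (c : ℂ),
        (List.ofFn fun i : Fin n =>
          ∑ k ∈ Finset.range K, (1 + (f i x : ℂ) * c) ^ k • A k).prod =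
            ∑ k, c ^ e k • C k x := by
  induction n with
  | zero => exact ⟨Unit, inferInstance, fun _ => 0, fun _ _ => 1, fun _ => continuous_const,
      fun x c => by simp⟩
  | succ n ih =>
    obtain ⟨ι, _, e, C, hC, h⟩ := ih (fun i => f i.succ) fun i => hf i.succ
    obtain ⟨κ, _, e', C', hC', h'⟩ := exists_sum_pow_smul_expansion A K (f 0) (hf 0)
    refine ⟨κ × ι, inferInstance, fun p => e' p.1 + e p.2, fun p x => C' p.1 x * C p.2 x,
      fun p => (hC' p.1).matrix_mul (hC p.2), fun x c => ?_⟩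
    rw [List.ofFn_succ, List.prod_cons, h, h', Fintype.sum_prod_type, Finset.sum_mul_sum]
    refine Finset.sum_congr rfl fun i _ => Finset.sum_congr rfl fun j _ => ?_
    rw [smul_mul_smul_comm, pow_add]

theorem analyticAt_integral_list_prod {N : ℕ} (A : ℕ → Matrix (Fin N) (Fin N) ℂ) (K n : ℕ)
    (i j : Fin N) (c₀ : ℂ) :
    AnalyticAt ℂ (fun c : ℂ => (∫ s in orderedSimplex n 0 1,
      (List.ofFn fun i : Fin n =>
        ∑ k ∈ Finset.range K, (1 + (s i : ℂ) * c) ^ k • A k).prod) i j) c₀ := by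
  obtain ⟨ι, _, e, C, hC, h⟩ := exists_list_prod_expansion A K n
    (fun (i : Fin n) (s : Fin n → ℝ) => s i) fun i => continuous_apply i
  have heq : ∀ c : ℂ, (∫ s in orderedSimplex n 0 1,
      (List.ofFn fun i : Fin n =>
        ∑ k ∈ Finset.range K, (1 + (s i : ℂ) * c) ^ k • A k).prod) =
      ∑ k, c ^ e k • ∫ s in orderedSimplex n 0 1, C k s := by
    intro c
    simp_rw [h]
    rw [integral_finsetSum]
    · simp_rw [integral_smul]
    · intro k _
      exact ((hC k).const_smul (c ^ e k)).continuousOn.integrableOn_compact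
        (isCompact_orderedSimplex n 0 1)
  simp_rw [heq, Matrix.sum_apply, Matrix.smul_apply, smul_eq_mul]
  fun_prop

theorem list_prod_ofFn_smul {N n : ℕ} (a : ℂ) (F : Fin n → Matrix (Fin N) (Fin N) ℂ) :
    (List.ofFn fun i => a • F i).prod = a ^ n • (List.ofFn F).prod := by
  induction n with
  | zero => simp
  | succ n ih => rw [List.ofFn_succ, List.ofFn_succ, List.prod_cons, List.prod_cons, ih,
      smul_mul_smul_comm, pow_succ']

theorem TexpPath_eq_sum {N : ℕ} (d : Fin N → ℂ)
    (hd : ∀ i j : Fin N, i < j → ∃ n : ℕ, 0 < n ∧ d i - d j = (n : ℂ))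
    (β : Matrix (Fin N) (Fin N) ℂ) (hβ : SUT β) (z c₀ c₁ : ℂ) :
    TexpPath d β z c₀ c₁ = ∑ n ∈ Finset.range N, (-z⁻¹ * (c₁ - c₀)) ^ n •
      ∫ s in orderedSimplex n 0 1,
        (List.ofFn fun i : Fin n => uYdiv d (c₀ + (s i : ℂ) * (c₁ - c₀)) β).prod := by
  have hsum : TexpPath d β z c₀ c₁ = ∑ n ∈ Finset.range N, ∫ s in orderedSimplex n 0 1,
      (List.ofFn fun i : Fin n =>
        (-z⁻¹ * (c₁ - c₀)) • uYdiv d (c₀ + (s i : ℂ) * (c₁ - c₀)) β).prod := by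
    refine tsum_eq_sum fun n hn => ?_
    rw [Finset.mem_range, not_lt] at hn
    rw [← integral_zero (Fin n → ℝ) (Matrix (Fin N) (Fin N) ℂ)
      (μ := volume.restrict (orderedSimplex n 0 1))]
    congr 1
    ext1 s
    refine SUT.list_prod_eq_zero _ (fun x hx => ?_) (by simpa using hn)
    obtain ⟨i, rfl⟩ := (List.mem_ofFn' _ _).1 hx
    exact (SUT.uYdiv hd hβ _).smul _
  rw [hsum]
  refine Finset.sum_congr rfl fun n _ => ?_
  simp_rw [list_prod_ofFn_smul]
  rw [integral_smul]

theorem matExp_smul_eq_sum {N : ℕ} {β : Matrix (Fin N) (Fin N) ℂ} (hβ : SUT β) (a : ℂ) :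
    matExp (a • β) =
      ∑ n ∈ Finset.range N, a ^ n • ((n.factorial : ℂ)⁻¹ • β ^ n) := by
  have : matExp (a • β) =
      ∑ n ∈ Finset.range N, ((n.factorial : ℂ)⁻¹) • (a • β) ^ n := by
    refine tsum_eq_sum fun n hn => ?_
    rw [Finset.mem_range, not_lt] at hn
    rw [(hβ.smul a).pow_eq_zero hn, smul_zero]
  rw [this]
  refine Finset.sum_congr rfl fun n _ => ?_
  rw [smul_pow, smul_comm]

theorem integral_orderedSimplex_const {N : ℕ} (n : ℕ) (x : Matrix (Fin N) (Fin N) ℂ) :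
    ∫ _ in orderedSimplex n 0 1, x = (n.factorial : ℂ)⁻¹ • x := by
  rw [setIntegral_const, Measure.real, volume_orderedSimplex n 0 1 zero_le_one,
    ENNReal.toReal_ofReal (by positivity)]
  ext i j
  simp

/-- The positive Birkhoff factor `γ_v^+(z) = Te^{−(1/z)∫_1^{v(z)} u^Y(β) du/u}`
extends holomorphically to `z = 0`, with value
`lim_{z→0} γ_v^+(z) = e^{−sβ}` where `s = v'(0)`. -/
theorem stmt12 {N : ℕ} (hN : 1 ≤ N) (d : Fin N → ℂ)
    (hd : ∀ i j : Fin N, i < j → ∃ n : ℕ, 0 < n ∧ d i - d j = (n : ℂ))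
    (β : Matrix (Fin N) (Fin N) ℂ) (hβ : SUT β)
    (v : ℂ → ℂ) (hv : AnalyticAt ℂ v 0) (hv0 : v 0 = 1) :
    ∃ g : ℂ → Matrix (Fin N) (Fin N) ℂ,
      (∀ i j : Fin N, AnalyticAt ℂ (fun z => g z i j) 0) ∧
      (∀ᶠ z in 𝓝[≠] (0 : ℂ), TexpPath d β z 1 (v z) = g z) ∧
      g 0 = matExp ((-(deriv v 0)) • β) ∧
      Filter.Tendsto (fun z => TexpPath d β z 1 (v z)) (𝓝[≠] (0 : ℂ))
        (𝓝 (matExp ((-(deriv v 0)) • β))) := by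
  obtain ⟨K, hK, hone⟩ := uYdiv_eq_sum d hd β hβ
  let w : ℂ → ℂ := dslope v 0
  have hw : AnalyticAt ℂ w 0 := by
    obtain ⟨p, hp⟩ := hv
    exact ⟨p.fslope, hp.has_fpower_series_dslope_fslope⟩
  let H : ℕ → ℂ → Matrix (Fin N) (Fin N) ℂ := fun n c => ∫ s in orderedSimplex n 0 1,
    (List.ofFn fun i : Fin n => uYdiv d (1 + (s i : ℂ) * c) β).prod
  have hH : ∀ n i j, AnalyticAt ℂ (fun c => H n c i j) (v 0 - 1) := by
    intro n i j
    simp only [H, hK]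
    exact analyticAt_integral_list_prod _ K n i j _
  let g : ℂ → Matrix (Fin N) (Fin N) ℂ := fun z =>
    ∑ n ∈ Finset.range N, (-w z) ^ n • H n (v z - 1)
  have hg : ∀ i j : Fin N, AnalyticAt ℂ (fun z => g z i j) 0 := by
    intro i j
    simp only [g, Matrix.sum_apply, Matrix.smul_apply, smul_eq_mul]
    refine Finset.analyticAt_fun_sum _ fun n _ => (hw.neg.pow n).mul ?_
    exact AnalyticAt.fun_comp (f := fun z => v z - 1) (hH n i j) (hv.fun_sub analyticAt_const)
  have heq : ∀ᶠ z in 𝓝[≠] (0 : ℂ), TexpPath d β z 1 (v z) = g z := by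
    filter_upwards [self_mem_nhdsWithin] with z hz
    rw [TexpPath_eq_sum d hd β hβ]
    refine Finset.sum_congr rfl fun n _ => ?_
    have : -z⁻¹ * (v z - 1) = -w z := by
      simp only [w, dslope_of_ne v hz, slope_def_field, hv0, sub_zero]
      ring
    rw [this]
  have hg0 : g 0 = matExp ((-(deriv v 0)) • β) := by
    rw [matExp_smul_eq_sum hβ]
    refine Finset.sum_congr rfl fun n _ => ?_
    simp only [w, H, dslope_same, hv0, sub_self, mul_zero, add_zero, hone, List.ofFn_const,
      List.prod_replicate]
    rw [integral_orderedSimplex_const]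
  refine ⟨g, hg, heq, hg0, ?_⟩
  have hcont : Tendsto g (𝓝[≠] (0 : ℂ)) (𝓝 (g 0)) :=
    (tendsto_pi_nhds.2 fun i => tendsto_pi_nhds.2 fun j =>
      (hg i j).continuousAt.tendsto).mono_left nhdsWithin_le_nhds
  rw [← hg0]
  exact hcont.congr' (heq.mono fun z hz => hz.symm)
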